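/- arXiv:2303.03614 — 3 statements merged into one kernel-verified Lean document; each statement's English description precedes it below -/
import Mathlib

section
/- Capacity-constraint characterization for insertion (Lemma 2): let d = [d₁, …, d_n] be a list of integers (d_k = +c_r if vertex vₖ is the origin of request r and d_k = −c_r if vₖ is its destination), and let num_k = d₁ + ⋯ + d_k (with num₀ = 0) be the number of passengers on board when leaving vₖ. Suppose the original route is feasible for worker capacity c_w, i.e., num_k ≤ c_w for all 0 ≤ k ≤ n. Let c ∈ ℤ and let d′ be the list obtained from d by inserting the entry +c immediately before position i and the entry −c immediately before position j, where 1 ≤ i ≤ j ≤ n+1. Then every partial sum of d′ is at most c_w if and only if num_k ≤ c_w − c for every k with i−1 ≤ k ≤ j−1. -/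
/-- Inserting `a` before index `m` leaves the prefix sums up to `m` unchanged; the later ones
are shifted by one position and increased by `a`. -/
theorem List.sum_take_insertIdx {M : Type*} [AddCommMonoid M] (l : List M) (a : M) (m k : ℕ)
    (hm : m ≤ l.length) :
    ((l.insertIdx m a).take k).sum =
      if k ≤ m then (l.take k).sum else (l.take (k - 1)).sum + a := by
  induction l generalizing m k with
  | nil =>
    obtain rfl : m = 0 := by simpa using hm
    cases k <;> simp
  | cons x l ih =>
    rcases m with _ | m
    · rcases k with _ | k <;> simp [add_comm]
    · rcases k with _ | k
      · simp
      · have h := ih m k (by simpa using hm)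
        rw [List.insertIdx_succ_cons, List.take_succ_cons, List.sum_cons, h]
        by_cases hk : k ≤ m
        · simp [hk]
        · obtain ⟨k, rfl⟩ : ∃ k', k = k' + 1 := ⟨k - 1, by omega⟩
          simp [hk, add_assoc]

/-- Capacity-constraint characterization for insertion (Lemma 2): `d` is the list of
passenger-count deltas along the route (`+c_r` at an origin, `-c_r` at a destination),
so `num k = (d.take k).sum` is the onboard count when leaving `v_k`. Suppose the
original route is feasible for capacity `cw`. Insert the entry `+c` immediately before
position `i` and the entry `-c` immediately before position `j` (1-indexed,
`1 ≤ i ≤ j ≤ n + 1`): the new list is `(d.insertIdx (i-1) c).insertIdx j (-c)`. Then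
every partial sum of the new list is at most `cw` iff `num k ≤ cw - c` for every `k`
with `i - 1 ≤ k ≤ j - 1`. -/
theorem capacity_insertion_iff (d : List ℤ) (cw c : ℤ) (i j : ℕ)
    (hi : 1 ≤ i) (hij : i ≤ j) (hj : j ≤ d.length + 1)
    (hfeas : ∀ k ≤ d.length, (d.take k).sum ≤ cw) :
    (∀ k ≤ d.length + 2, (((d.insertIdx (i - 1) c).insertIdx j (-c)).take k).sum ≤ cw) ↔
      (∀ k, i - 1 ≤ k → k ≤ j - 1 → (d.take k).sum ≤ cw - c) := by
  have hlen : (d.insertIdx (i - 1) c).length = d.length + 1 :=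
    List.length_insertIdx_of_le_length (by omega) _
  have hsum : ∀ k, (((d.insertIdx (i - 1) c).insertIdx j (-c)).take k).sum =
      if k ≤ j then (if k ≤ i - 1 then (d.take k).sum else (d.take (k - 1)).sum + c)
      else (d.take (k - 2)).sum := by
    intro k
    rw [List.sum_take_insertIdx _ _ _ _ (by omega), List.sum_take_insertIdx _ _ _ _ (by omega),
      List.sum_take_insertIdx _ _ _ _ (by omega)]
    split_ifs with hkj _ hki
    · rfl
    · rfl
    · omega
    · rw [add_neg_cancel_right, Nat.sub_sub]
  constructor
  · intro h k hik hkj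
    have hk := h (k + 1) (by omega)
    rw [hsum, if_pos (by omega), if_neg (by omega), Nat.add_sub_cancel] at hk
    linarith
  · intro h k hk
    rw [hsum]
    split_ifs with hkj hki
    · exact hfeas k (by omega)
    · linarith [h (k - 1) (by omega) (by omega)]
    · exact hfeas (k - 2) (by omega)
end

section
/- Feasibility of the new route after an insertion (Lemma 1, full insertion form, sufficiency): consider a route v₀, …, v_n with monotone arrival maps gₖ : ℝ → ℝ (from vₖ to v_{k+1}, ₀ ≤ k < n), arrival times arr_{k+1} = gₖ(arr_k), deadlines e_k, and latest times satisfying arr_k ≤ latest_k ≤ e_k for all k and gₖ(latest_k) ≤ latest_{k+1} for all k < n. Insert a new request with deadline e⁺: choose 1 ≤ i < j ≤ n and monotone arrival maps p (from v_{i−1} to the new origin o⁺), q (from o⁺ to v_i), u (from v_{j−1} to the new destination d⁺), and w (from d⁺ to v_j). Define the new arrival times: pick = p(arr_{i−1}); arr′_i = q(pick); arr′_k = g_{k−1}(arr′_{k−1}) for i < k ≤ j−1; deliver = u(arr′_{j−1}); arr′_j = w(deliver); arr′_k = g_{k−1}(arr′_{k−1}) for j < k ≤ n. If (1) pick ≤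 e⁺, (2) arr′_i ≤ latest_i, (3) deliver ≤ e⁺, and (4) arr′_j ≤ latest_j, then no deadline constraint of the new route is violated: deliver ≤ e⁺ for the new request and arr′_k ≤ e_k for every k with i ≤ k ≤ n. -/
/-- Feasibility of the new route after an insertion (Lemma 1, full insertion form,
sufficiency): with monotone arrival maps `g k`, arrival times `arr`, deadlines `e`,
and latest times `latest` satisfying `arr k ≤ latest k ≤ e k` and
`g k (latest k) ≤ latest (k+1)`, insert a new request (deadline `eplus`) at positions
`1 ≤ i < j ≤ n` via monotone arrival maps `p, q, u, w` for the four new legs. If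
(1) `pick ≤ eplus`, (2) `arr' i ≤ latest i`, (3) `deliver ≤ eplus`, and
(4) `arr' j ≤ latest j`, then no deadline constraint of the new route is violated. -/
theorem insertion_feasible (n i j : ℕ) (hi : 1 ≤ i) (hij : i < j) (hjn : j ≤ n)
    (g : ℕ → ℝ → ℝ) (hg : ∀ k < n, Monotone (g k))
    (arr e latest : ℕ → ℝ)
    (harr : ∀ k < n, arr (k + 1) = g k (arr k))
    (harrle : ∀ k ≤ n, arr k ≤ latest k)
    (hlate : ∀ k ≤ n, latest k ≤ e k)
    (hlat : ∀ k < n, g k (latest k) ≤ latest (k + 1))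
    (p q u w : ℝ → ℝ)
    (hp : Monotone p) (hq : Monotone q) (hu : Monotone u) (hw : Monotone w)
    (eplus : ℝ) (pick deliver : ℝ) (arr' : ℕ → ℝ)
    (hpick : pick = p (arr (i - 1)))
    (harri : arr' i = q pick)
    (hmid : ∀ k, i < k → k ≤ j - 1 → arr' k = g (k - 1) (arr' (k - 1)))
    (hdel : deliver = u (arr' (j - 1)))
    (harrj : arr' j = w deliver)
    (hafter : ∀ k, j < k → k ≤ n → arr' k = g (k - 1) (arr' (k - 1)))
    (c1 : pick ≤ eplus)
    (c2 : arr' i ≤ latest i)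
    (c3 : deliver ≤ eplus)
    (c4 : arr' j ≤ latest j) :
    deliver ≤ eplus ∧ ∀ k, i ≤ k → k ≤ n → arr' k ≤ e k := by
  have key : ∀ k, i ≤ k → k ≤ n → arr' k ≤ latest k := by
    intro k hik
    induction k, hik using Nat.le_induction with
    | base => exact fun _ => c2
    | succ k hik ih =>
      intro hkn
      by_cases hkj : k + 1 = j
      · rwa [hkj]
      · have hstep : arr' (k + 1) = g k (arr' k) := by
          rcases lt_or_gt_of_ne hkj with h | h
          · exact hmid (k + 1) (by omega) (by omega)
          · exact hafter (k + 1) h hkn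
        rw [hstep]
        exact (hg k hkn (ih (by omega))).trans (hlat k hkn)
  exact ⟨c3, fun k hik hkn => (key k hik hkn).trans (hlate k hkn)⟩
end

section
/- Piecewise update of arrival times after insertion (correctness of Equation (4)): let the original route have edge travel-time functions f₀, …, f_{n−1} and arrival times arr 0 = t₀, arr (k+1) = arr k + fₖ(arr k). Insert the new origin just before vertex v_i (replacing the edge function f_{i−1} by two functions p_f, q_f) and the new destination just before vertex v_j (replacing f_{j−1} by two functions u_f, w_f), with i < j, and let arr′ denote the arrival times of the resulting route defined by the same recursion applied to the new list of edge functions. Then: (a) arr′_k = arr_k for all k < i; (b) arr′_k = arr′_i + travel_{[f_i, …, f_{k−1}]}(arr′_i) for all i ≤ k ≤ j−1; and (c) arr′_k = arr′_j + travel_{[f_j, …, f_{k−1}]}(arr′_j) for all j ≤ k ≤ n, where travel_M denotes the compound travel-time function of the sub-list M of the original route's edge functions. In particular, the arrival times at vertices strictly between the two insertion points, and after the second insertion point, are obtained from arr′_i (respectively arr′_j) via the compound travel-time functions of the unchanged sub-routes of the original route. -/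
/-- Arrival step: departing at time `t` along an edge with travel-time function `h`,
one arrives at `t + h t`. -/
noncomputable def step (t : ℝ) (h : ℝ → ℝ) : ℝ := t + h t

/-- Compound travel-time function of a list of edge travel-time functions. -/
noncomputable def travel (L : List (ℝ → ℝ)) (t : ℝ) : ℝ := L.foldl step t - t

/-- Arrival time at the `k`-th vertex of the route with edge travel-time functions `L`
and start time `t₀`, i.e. the recursion `arr 0 = t₀`, `arr (k+1) = arr k + Lₖ (arr k)`. -/
noncomputable def arrOf (L : List (ℝ → ℝ)) (t₀ : ℝ) (k : ℕ) : ℝ := (L.take k).foldl step t₀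

/-- `subRoute f x y = [f x, f (x+1), …, f (y-1)]`: the edge travel-time functions of the
sub-route from vertex `v_x` to vertex `v_y`. -/
def subRoute (f : ℕ → ℝ → ℝ) (x y : ℕ) : List (ℝ → ℝ) :=
  (List.range (y - x)).map (fun k => f (x + k))

theorem take_subRoute (f : ℕ → ℝ → ℝ) {x k y : ℕ} (hky : k ≤ y) :
    (subRoute f x y).take (k - x) = subRoute f x k := by
  rw [subRoute, subRoute, ← List.map_take, List.take_range, min_eq_left (by omega)]

theorem foldl_step_eq_add_travel (L : List (ℝ → ℝ)) (t : ℝ) :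
    L.foldl step t = t + travel L t := by
  simp [travel]

/-- Arrival times inside a block `subRoute f x y` of a route, in terms of the time at which
the block is entered. -/
theorem arrOf_append_subRoute (A C : List (ℝ → ℝ)) (f : ℕ → ℝ → ℝ) {x k y : ℕ} (t : ℝ)
    (hxk : x ≤ k) (hky : k ≤ y) :
    arrOf (A ++ (subRoute f x y ++ C)) t (A.length + (k - x)) =
      A.foldl step t + travel (subRoute f x k) (A.foldl step t) := by
  have hlen : k - x ≤ (subRoute f x y).length := by
    simp only [subRoute, List.length_map, List.length_range]
    omega
  rw [arrOf, List.take_length_add_append, List.take_append_of_le_length hlen,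
    take_subRoute f hky, List.foldl_append, foldl_step_eq_add_travel (subRoute f x k)]

theorem travel_subRoute_self (f : ℕ → ℝ → ℝ) (x : ℕ) (t : ℝ) :
    travel (subRoute f x x) t = 0 := by
  simp [travel, subRoute]

/-- Piecewise update of arrival times after insertion (Equation (4)): the original route
has edge functions `[f 0, …, f (n-1)]` and arrival times `arr`. The new route replaces
`f (i-1)` by the two legs `pf, qf` (new origin just before `v_i`) and `f (j-1)` by
`uf, wf` (new destination just before `v_j`), `i < j`; in the new route the original
vertex `v_k` sits at position `k` (if `k < i`), `k+1` (if `i ≤ k ≤ j-1`), or `k+2`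
(if `k ≥ j`), and `arr' k` is its arrival time there. Then (a) `arr' k = arr k` for
`k < i`; (b) `arr' k = arr' i + travel [f i, …, f (k-1)] (arr' i)` for `i ≤ k ≤ j-1`;
(c) `arr' k = arr' j + travel [f j, …, f (k-1)] (arr' j)` for `j ≤ k ≤ n`. -/
theorem insertion_arrival_update (n i j : ℕ) (hi : 1 ≤ i) (hij : i < j) (hjn : j ≤ n)
    (f : ℕ → ℝ → ℝ) (pf qf uf wf : ℝ → ℝ) (t₀ : ℝ)
    (newL : List (ℝ → ℝ))
    (hnewL : newL = (List.range (i - 1)).map f ++ [pf, qf] ++ subRoute f i (j - 1)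
      ++ [uf, wf] ++ subRoute f j n)
    (arr : ℕ → ℝ) (harr : arr = arrOf (subRoute f 0 n) t₀)
    (arr' : ℕ → ℝ)
    (harr' : arr' = fun k => if k < i then arrOf newL t₀ k
      else if k ≤ j - 1 then arrOf newL t₀ (k + 1) else arrOf newL t₀ (k + 2)) :
    (∀ k < i, arr' k = arr k) ∧
      (∀ k, i ≤ k → k ≤ j - 1 → arr' k = arr' i + travel (subRoute f i k) (arr' i)) ∧
      (∀ k, j ≤ k → k ≤ n → arr' k = arr' j + travel (subRoute f j k) (arr' j)) := by
  subst hnewL harr harr'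
  have hprefix : (List.range (i - 1)).map f = subRoute f 0 (i - 1) := by simp [subRoute]
  rw [hprefix]
  refine ⟨fun k hk => ?_, fun k hik hkj => ?_, fun k hjk hkn => ?_⟩
  · have hnew := arrOf_append_subRoute [] ([pf, qf] ++ subRoute f i (j - 1)
      ++ [uf, wf] ++ subRoute f j n) f t₀ (Nat.zero_le k) (show k ≤ i - 1 by omega)
    have hold := arrOf_append_subRoute [] [] f t₀ (Nat.zero_le k) (show k ≤ n by omega)
    simp only [List.length_nil, Nat.zero_add, Nat.sub_zero, List.nil_append,
      List.append_nil] at hnew hold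
    simp only [if_pos hk, List.append_assoc] at hnew ⊢
    rw [hnew, hold]
  · have hnew (m : ℕ) (him : i ≤ m) (hmj : m ≤ j - 1) :=
      arrOf_append_subRoute (subRoute f 0 (i - 1) ++ [pf, qf])
        ([uf, wf] ++ subRoute f j n) f t₀ him hmj
    have hlen (m : ℕ) (him : i ≤ m) :
        (subRoute f 0 (i - 1) ++ [pf, qf]).length + (m - i) = m + 1 := by
      simp only [subRoute, List.length_append, List.length_map, List.length_range,
        List.length_cons, List.length_nil]
      omega
    have hk := hnew k hik hkj
    have hentry := hnew i le_rfl (by omega)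
    rw [hlen k hik] at hk
    rw [hlen i le_rfl, travel_subRoute_self, add_zero] at hentry
    rw [← hentry] at hk
    simpa only [if_neg (not_lt.mpr hik), if_pos hkj, lt_irrefl, if_false,
      if_pos (show i ≤ j - 1 by omega), List.append_assoc] using hk
  · have hnew (m : ℕ) (hjm : j ≤ m) (hmn : m ≤ n) :=
      arrOf_append_subRoute (subRoute f 0 (i - 1) ++ [pf, qf] ++ subRoute f i (j - 1)
        ++ [uf, wf]) [] f t₀ hjm hmn
    have hlen (m : ℕ) (hjm : j ≤ m) :
        (subRoute f 0 (i - 1) ++ [pf, qf] ++ subRoute f i (j - 1)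
          ++ [uf, wf]).length + (m - j) = m + 2 := by
      simp only [subRoute, List.length_append, List.length_map, List.length_range,
        List.length_cons, List.length_nil]
      omega
    have hk := hnew k hjk hkn
    have hentry := hnew j le_rfl hjn
    rw [hlen k hjk] at hk
    rw [hlen j le_rfl, travel_subRoute_self, add_zero] at hentry
    rw [← hentry] at hk
    simpa only [if_neg (show ¬ k < i by omega), if_neg (show ¬ k ≤ j - 1 by omega),
      if_neg (show ¬ j < i by omega), if_neg (show ¬ j ≤ j - 1 by omega),
      List.append_assoc, List.append_nil] using hk
end
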